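/- For probability measures μ, ν on ℝ^d with finite fourth moments, the infimum over couplings γ ∈ Π(μ,ν) of ∬ ‖x⊙x' − y⊙y'‖² dγ(x,y) dγ(x',y') is attained (a minimizer exists). -/

import Mathlib

open MeasureTheory

open scoped NNReal ENNReal BoundedContinuousFunction

/-- The integral of a continuous nonnegative function is lower semicontinuous for the topology of
convergence in distribution. -/
theorem lowerSemicontinuous_lintegral_probabilityMeasure {X : Type*} [TopologicalSpace X]
    [MeasurableSpace X] [OpensMeasurableSpace X] {f : X → ℝ≥0} (hf : Continuous f) :
    LowerSemicontinuous fun P : ProbabilityMeasure X ↦ ∫⁻ x, (f x : ℝ≥0∞) ∂(P : Measure X) := by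
  let g : ℕ → X →ᵇ ℝ≥0 := fun n ↦
    BoundedContinuousFunction.mkOfBound ⟨fun x ↦ min (f x) n, by fun_prop⟩ n fun x y ↦ by
      rw [NNReal.dist_eq]
      refine abs_sub_le_of_nonneg_of_le (by positivity) ?_ (by positivity) ?_ <;>
        exact_mod_cast min_le_right _ _
  have hg : ∀ n x, g n x = min (f x) n := fun _ _ ↦ rfl
  have hsup : ∀ x, (f x : ℝ≥0∞) = ⨆ n, (g n x : ℝ≥0∞) := fun x ↦ by
    refine le_antisymm ?_ (iSup_le fun n ↦ by simp [hg])
    obtain ⟨n, hn⟩ := exists_nat_ge (f x)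
    exact le_iSup_of_le n (by rw [hg, min_eq_left hn])
  have hmono : Monotone fun n x ↦ (g n x : ℝ≥0∞) := fun m n hmn x ↦ by
    have : (m : ℝ≥0) ≤ n := by exact_mod_cast hmn
    simpa only [hg, ENNReal.coe_le_coe] using min_le_min_left (f x) this
  have hint : (fun P : ProbabilityMeasure X ↦ ∫⁻ x, (f x : ℝ≥0∞) ∂(P : Measure X)) =
      fun P : ProbabilityMeasure X ↦ ⨆ n, ∫⁻ x, (g n x : ℝ≥0∞) ∂(P : Measure X) := by
    funext P
    simp_rw [hsup]
    exact lintegral_iSup (fun n ↦ (g n).continuous.measurable.coe_nnreal_ennreal) hmono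
  rw [hint]
  exact lowerSemicontinuous_iSup fun n ↦
    (ProbabilityMeasure.continuous_lintegral_boundedContinuousFunction (g n)).lowerSemicontinuous

/-- The product measure is a coupling. -/
theorem setOf_coupling_nonempty {X Y : Type*} [MeasurableSpace X] [MeasurableSpace Y]
    (μ : ProbabilityMeasure X) (ν : ProbabilityMeasure Y) :
    {P : ProbabilityMeasure (X × Y) |
      (P : Measure (X × Y)).map Prod.fst = μ ∧ (P : Measure (X × Y)).map Prod.snd = ν}.Nonempty :=
  ⟨μ.prod ν, Measure.fst_prod, Measure.snd_prod⟩

/-- The set of couplings of two probability measures on Polish spaces is compact for the topology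
of convergence in distribution. -/
theorem isCompact_setOf_coupling {X Y : Type*}
    [TopologicalSpace X] [PolishSpace X] [MeasurableSpace X] [BorelSpace X]
    [TopologicalSpace Y] [PolishSpace Y] [MeasurableSpace Y] [BorelSpace Y]
    (μ : ProbabilityMeasure X) (ν : ProbabilityMeasure Y) :
    IsCompact {P : ProbabilityMeasure (X × Y) |
      (P : Measure (X × Y)).map Prod.fst = μ ∧ (P : Measure (X × Y)).map Prod.snd = ν} := by
  have hclosed : IsClosed {P : ProbabilityMeasure (X × Y) |
      (P : Measure (X × Y)).map Prod.fst = μ ∧ (P : Measure (X × Y)).map Prod.snd = ν} := by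
    let := TopologicalSpace.upgradeIsCompletelyMetrizable X
    let := TopologicalSpace.upgradeIsCompletelyMetrizable Y
    have h₁ := isClosed_singleton (x := μ) |>.preimage
      (ProbabilityMeasure.continuous_map (continuous_fst (X := X) (Y := Y)))
    have h₂ := isClosed_singleton (x := ν) |>.preimage
      (ProbabilityMeasure.continuous_map (continuous_snd (X := X) (Y := Y)))
    convert h₁.inter h₂ using 1
    ext P
    simp [← ProbabilityMeasure.toMeasure_injective.eq_iff]
  rw [← hclosed.closure_eq]
  refine isCompact_closure_of_isTightMeasureSet (IsTightMeasureSet.prodMk ?_ ?_)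
  · refine (isTightMeasureSet_singleton (μ := (μ : Measure X))).subset ?_
    rintro _ ⟨_, ⟨P, hP, rfl⟩, rfl⟩
    exact hP.1
  · refine (isTightMeasureSet_singleton (μ := (ν : Measure Y))).subset ?_
    rintro _ ⟨_, ⟨P, hP, rfl⟩, rfl⟩
    exact hP.2

/-- For probability measures `μ, ν` on `ℝ^d` with finite fourth moments, the infimum over
couplings `γ ∈ Π(μ,ν)` of `∬ ‖x⊙x' − y⊙y'‖² dγ(x,y) dγ(x',y')` is attained, where
`⊙` is the coordinatewise product and `‖·‖` the Euclidean norm (written as a sum of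
squares). -/
theorem hadamardWasserstein_exists_minimizer {d : ℕ}
    (μ ν : Measure (Fin d → ℝ)) [IsProbabilityMeasure μ] [IsProbabilityMeasure ν]
    (hμ4 : ∫⁻ x, ENNReal.ofReal ((∑ i, (x i) ^ 2) ^ 2) ∂μ < ⊤)
    (hν4 : ∫⁻ y, ENNReal.ofReal ((∑ i, (y i) ^ 2) ^ 2) ∂ν < ⊤) :
    ∃ γ : Measure ((Fin d → ℝ) × (Fin d → ℝ)),
      (γ.map Prod.fst = μ ∧ γ.map Prod.snd = ν) ∧
      ∀ γ' : Measure ((Fin d → ℝ) × (Fin d → ℝ)),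
        γ'.map Prod.fst = μ → γ'.map Prod.snd = ν →
        (∫⁻ w, ENNReal.ofReal (∑ i, (w.1.1 i * w.2.1 i - w.1.2 i * w.2.2 i) ^ 2)
            ∂(γ.prod γ)) ≤
        (∫⁻ w, ENNReal.ofReal (∑ i, (w.1.1 i * w.2.1 i - w.1.2 i * w.2.2 i) ^ 2)
            ∂(γ'.prod γ')) := by
  have hcont : Continuous fun w : ((Fin d → ℝ) × (Fin d → ℝ)) × ((Fin d → ℝ) × (Fin d → ℝ)) ↦
      (∑ i, (w.1.1 i * w.2.1 i - w.1.2 i * w.2.2 i) ^ 2).toNNReal := by fun_prop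
  have hlsc := LowerSemicontinuous.comp
    (lowerSemicontinuous_lintegral_probabilityMeasure hcont)
    ((ProbabilityMeasure.continuous_prod
      (α := (Fin d → ℝ) × (Fin d → ℝ)) (β := (Fin d → ℝ) × (Fin d → ℝ))).comp
      (continuous_id.prodMk continuous_id))
  obtain ⟨P, hP, hmin⟩ := LowerSemicontinuousOn.exists_isMinOn
    (setOf_coupling_nonempty ⟨μ, inferInstance⟩ ⟨ν, inferInstance⟩)
    (isCompact_setOf_coupling _ _) (hlsc.lowerSemicontinuousOn _)
  refine ⟨P, hP, fun γ' h₁ h₂ ↦ ?_⟩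
  have : IsProbabilityMeasure γ' := by
    constructor
    rw [← Set.preimage_univ (f := Prod.fst), ← Measure.map_apply measurable_fst .univ, h₁,
      measure_univ]
  exact hmin (a := ⟨γ', this⟩) ⟨h₁, h₂⟩
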